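/- For every natural number n, the number of triples (n1, n2, n3) of nonnegative integers with T(n1) + T(n2) + 2·T(n3) = n is positive, where T(m) = m(m+1)/2 is the m-th triangular number. -/

import Mathlib

/-- Modulo `a > 0`, every integer has a representative of absolute value at most `a / 2`. -/
theorem exists_four_mul_add_mul_sq_le (a b : ℤ) (ha : 0 < a) :
    ∃ k : ℤ, 4 * (b + k * a) ^ 2 ≤ a ^ 2 := by
  have h₁ := Int.emod_add_mul_ediv (2 * b + a) (2 * a)
  have h₂ := Int.emod_nonneg (2 * b + a) (by lia : 2 * a ≠ 0)
  have h₃ := Int.emod_lt_of_pos (2 * b + a) (by lia : 0 < 2 * a)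
  refine ⟨-((2 * b + a) / (2 * a)), ?_⟩
  have hle : 2 * (b + -((2 * b + a) / (2 * a)) * a) ≤ a := by linarith
  have hge : -a ≤ 2 * (b + -((2 * b + a) / (2 * a)) * a) := by linarith
  nlinarith

/-- A reduced pair of diagonal coefficients whose minor is small compared with `a` improves
on `a`. -/
theorem pos_and_lt_of_reduced {a a' f g : ℤ} (ha : 1 < a) (hg : 0 < g) (hga : 3 * g ^ 2 ≤ 4 * a)
    (hf : 4 * f ^ 2 ≤ a ^ 2) (hminor : a' * a - f ^ 2 = g) : 0 < a' ∧ a' < a := by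
  constructor
  · by_contra! hneg
    nlinarith [sq_nonneg f]
  · by_contra! hge
    have h₁ : 3 * a ^ 2 ≤ 4 * g := by nlinarith
    have h₂ : 3 * a ≤ 2 * g := by nlinarith
    nlinarith

/-- A positive definite binary integral form of determinant `D` takes, at the first column of
some unimodular substitution, a value `g` with `3 * g ^ 2 ≤ 4 * D`. -/
theorem exists_unimodular_binary_form_le (D : ℤ) (hD : 0 < D) (A B C : ℤ) (hA : 0 < A)
    (hdet : A * C - B ^ 2 = D) :
    ∃ p q r s : ℤ, p * s - q * r = 1 ∧ 0 < A * p ^ 2 + 2 * B * p * r + C * r ^ 2 ∧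
      3 * (A * p ^ 2 + 2 * B * p * r + C * r ^ 2) ^ 2 ≤ 4 * D := by
  induction h : A.toNat using Nat.strong_induction_on generalizing A B C with
  | _ N ih =>
  obtain ⟨k, hsq⟩ := exists_four_mul_add_mul_sq_le A B hA
  set B' := B + k * A with hB'
  set C' := A * k ^ 2 + 2 * B * k + C with hC'
  have hdet' : A * C' - B' ^ 2 = D := by rw [hB', hC', ← hdet]; ring
  rcases le_or_gt A C' with hle | hlt
  · exact ⟨1, 0, 0, 1, by norm_num, by simpa using hA, by ring_nf; nlinarith⟩
  · have hpos_C : 0 < C' := by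
      by_contra hneg
      nlinarith [sq_nonneg B']
    obtain ⟨p, q, r, s, hu, hpos, hg⟩ :=
      ih C'.toNat (by lia) C' (-B') A hpos_C (by rw [← hdet']; ring) rfl
    have hval : A * (k * p - r) ^ 2 + 2 * B * (k * p - r) * p + C * p ^ 2
        = C' * p ^ 2 + 2 * (-B') * p * r + A * r ^ 2 := by
      rw [hB', hC']; ring
    exact ⟨k * p - r, k * q - s, p, q, by linear_combination hu, hval ▸ hpos, hval ▸ hg⟩

/-- A positive definite binary integral form of determinant one only takes sums of two squares
as values. -/
theorem binary_form_eq_sq_add_sq (A B C : ℤ) (hA : 0 < A) (hdet : A * C - B ^ 2 = 1) (y z : ℤ) :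
    ∃ u v : ℤ, A * y ^ 2 + 2 * B * y * z + C * z ^ 2 = u ^ 2 + v ^ 2 := by
  obtain ⟨p, q, r, s, hu, hpos, hg⟩ :=
    exists_unimodular_binary_form_le 1 one_pos A B C hA hdet
  have hone : A * p ^ 2 + 2 * B * p * r + C * r ^ 2 = 1 := by nlinarith
  have hlead : ∀ F H t w : ℤ, H - F ^ 2 = 1 →
      t ^ 2 + 2 * F * t * w + H * w ^ 2 = (t + F * w) ^ 2 + w ^ 2 := by
    intro F H t w h
    linear_combination w ^ 2 * h
  set F := A * p * q + B * (p * s + q * r) + C * r * s with hF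
  set H := A * q ^ 2 + 2 * B * q * s + C * s ^ 2 with hH
  have hFH : H - F ^ 2 = 1 := by
    have : (A * p ^ 2 + 2 * B * p * r + C * r ^ 2) * H - F ^ 2
        = (A * C - B ^ 2) * (p * s - q * r) ^ 2 := by rw [hF, hH]; ring
    rw [hone, hdet, hu] at this
    linarith
  refine ⟨s * y - q * z + F * (p * z - r * y), p * z - r * y, ?_⟩
  rw [← hlead F H _ _ hFH]
  have hy : p * (s * y - q * z) + q * (p * z - r * y) = y := by linear_combination y * hu
  have hz : r * (s * y - q * z) + s * (p * z - r * y) = z := by linear_combination z * hu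
  generalize s * y - q * z = t at *
  generalize p * z - r * y = w at *
  rw [← hy, ← hz, hF, hH]
  linear_combination t ^ 2 * hone

/-- A positive definite ternary integral form of determinant one only takes sums of three squares
as values. -/
theorem ternary_form_eq_sq_add_sq_add_sq (a b c d e f : ℤ) (ha : 0 < a) (hab : 0 < a * b - f ^ 2)
    (hdet : a * b * c + 2 * d * e * f - a * d ^ 2 - b * e ^ 2 - c * f ^ 2 = 1) (x y z : ℤ) :
    ∃ u v w : ℤ, a * x ^ 2 + b * y ^ 2 + c * z ^ 2 + 2 * d * y * z + 2 * e * x * z + 2 * f * x * y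
      = u ^ 2 + v ^ 2 + w ^ 2 := by
  induction h : a.toNat using Nat.strong_induction_on generalizing a b c d e f x y z with
  | _ N ih =>
  have hG : (a * b - f ^ 2) * (a * c - e ^ 2) - (a * d - e * f) ^ 2 = a := by
    linear_combination a * hdet
  rcases eq_or_ne a 1 with rfl | hne
  · obtain ⟨v, w, hvw⟩ := binary_form_eq_sq_add_sq _ _ _ hab hG y z
    exact ⟨x + f * y + e * z, v, w, by linear_combination hvw⟩
  obtain ⟨p, q, r, s, hu, hpos, hg⟩ := exists_unimodular_binary_form_le a ha _ _ _ hab hG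
  set g := (a * b - f ^ 2) * p ^ 2 + 2 * (a * d - e * f) * p * r + (a * c - e ^ 2) * r ^ 2
    with hgdef
  obtain ⟨k, hsq⟩ := exists_four_mul_add_mul_sq_le a (f * p + e * r) ha
  -- The form in the basis `(k, p, r)`, `(1, 0, 0)`, `(0, q, s)`.
  set f' := f * p + e * r + k * a with hf'
  set a' := a * k ^ 2 + b * p ^ 2 + c * r ^ 2 + 2 * d * p * r + 2 * e * k * r + 2 * f * k * p
    with ha'
  set c' := b * q ^ 2 + c * s ^ 2 + 2 * d * q * s with hc'
  set d' := f * q + e * s with hd'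
  set e' := b * p * q + c * r * s + d * (p * s + q * r) + e * k * s + f * k * q with he'
  have hminor : a' * a - f' ^ 2 = g := by rw [ha', hf', hgdef]; ring
  obtain ⟨hpos_a, hlt⟩ := pos_and_lt_of_reduced (by lia) hpos hg hsq hminor
  have hdet' : a' * a * c' + 2 * d' * e' * f' - a' * d' ^ 2 - a * e' ^ 2 - c' * f' ^ 2 = 1 := by
    have : a' * a * c' + 2 * d' * e' * f' - a' * d' ^ 2 - a * e' ^ 2 - c' * f' ^ 2
        = (a * b * c + 2 * d * e * f - a * d ^ 2 - b * e ^ 2 - c * f ^ 2)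
          * (p * s - q * r) ^ 2 := by
      rw [ha', hc', hd', he', hf']; ring
    rw [this, hdet, hu]; norm_num
  obtain ⟨u, v, w, huvw⟩ := ih a'.toNat (by lia) a' a c' d' e' f' hpos_a (hminor ▸ hpos) hdet'
    (s * y - q * z) (x - k * (s * y - q * z)) (p * z - r * y) rfl
  refine ⟨u, v, w, ?_⟩
  rw [← huvw]
  have hy : p * (s * y - q * z) + q * (p * z - r * y) = y := by linear_combination y * hu
  have hz : r * (s * y - q * z) + s * (p * z - r * y) = z := by linear_combination z * hu
  generalize s * y - q * z = t at *
  generalize p * z - r * y = t' at *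
  rw [← hy, ← hz, ha', hc', hd', he', hf']
  ring

/-- If `p = b * m - 1` is a prime with `m ≡ 2 [MOD 4]` and `b ≡ 1 [MOD 4]`, then `-b` is a
square modulo `p`. -/
theorem isSquare_neg_of_prime_add_one_eq_mul {p b m : ℕ} [Fact p.Prime] (hm : m % 4 = 2)
    (hb : b % 4 = 1) (hp : p + 1 = b * m) : IsSquare ((-b : ℤ) : ZMod p) := by
  have hp4 : p % 4 = 1 := by
    have : (p + 1) % 4 = 2 := by rw [hp, Nat.mul_mod, hb, hm]
    lia
  have hjac : jacobiSym (-b) p = 1 := by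
    rw [jacobiSym.neg _ (Nat.odd_iff.2 (by lia)), ZMod.χ₄_nat_one_mod_four hp4, one_mul,
      jacobiSym.quadratic_reciprocity_one_mod_four hb (Nat.odd_iff.2 (by lia)),
      jacobiSym.mod_left' (a₂ := -1), jacobiSym.at_neg_one (Nat.odd_iff.2 (by lia)),
      ZMod.χ₄_nat_one_mod_four hb]
    refine (Int.modEq_iff_dvd.2 ⟨m, ?_⟩).symm
    zify at hp
    linear_combination hp
  rw [← jacobiSym.legendreSym.to_jacobiSym] at hjac
  refine (legendreSym.eq_one_iff p ?_).1 hjac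
  intro h0
  rw [(legendreSym.eq_zero_iff p _).2 h0] at hjac
  exact zero_ne_one hjac

/-- Every natural number congruent to two modulo four is a sum of three integer squares. -/
theorem exists_sq_add_sq_add_sq_of_mod_four_eq_two (m : ℕ) (hm : m % 4 = 2) :
    ∃ u v w : ℤ, (m : ℤ) = u ^ 2 + v ^ 2 + w ^ 2 := by
  have hcop : (m - 1).Coprime (4 * m) := by
    refine Nat.Coprime.mul_right ?_ ?_
    · exact Nat.Coprime.pow_right 2 (Nat.coprime_two_right.2 (Nat.odd_iff.2 (by lia)))
    · exact (Nat.coprime_self_sub_left (by lia)).2 (Nat.coprime_one_left m)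
  obtain ⟨p, hpm, hprime, hpmod⟩ :=
    Nat.forall_exists_prime_gt_and_modEq m (by lia : 4 * m ≠ 0) hcop
  have : Fact p.Prime := ⟨hprime⟩
  obtain ⟨v, hv⟩ := (Nat.modEq_iff_dvd' (by lia)).1 hpmod.symm
  have hpb : p + 1 = (4 * v + 1) * m := by
    have : p = 4 * m * v + (m - 1) := by lia
    rw [this, add_assoc, Nat.sub_add_cancel (by lia)]; ring
  obtain ⟨t, ht⟩ := isSquare_neg_of_prime_add_one_eq_mul hm (by lia) hpb
  obtain ⟨f, rfl⟩ := ZMod.intCast_surjective t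
  rw [← Int.cast_mul, ZMod.intCast_eq_intCast_iff_dvd_sub] at ht
  obtain ⟨b, hb⟩ := ht
  have hpb' : (p : ℤ) + 1 = (4 * v + 1) * m := by exact_mod_cast hpb
  push_cast at hb
  obtain ⟨x, y, w, h⟩ := ternary_form_eq_sq_add_sq_add_sq p b m 1 0 f
    (by exact_mod_cast hprime.pos) (by nlinarith) (by linear_combination -(m : ℤ) * hb - hpb') 0 0 1
  exact ⟨x, y, w, by linear_combination h⟩

/-- The square of an odd integer is one more than eight times a triangular number. -/
theorem Odd.exists_sq_eq_eight_mul_triangular_add_one {x : ℤ} (hx : Odd x) :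
    ∃ i : ℕ, x ^ 2 = 8 * (i * (i + 1) / 2 : ℕ) + 1 := by
  obtain ⟨i, hi⟩ := Int.natAbs_odd.2 hx
  refine ⟨i, ?_⟩
  have h : 2 * (i * (i + 1) / 2) = i * (i + 1) :=
    Nat.mul_div_cancel' (Nat.even_mul_succ_self i).two_dvd
  rw [← Int.natAbs_sq, hi]
  zify at h
  push_cast
  linear_combination -4 * h

/-- If `4 * n + 2` is a sum of three squares, of which exactly the second has even base, then `n`
is a sum of two triangular numbers and twice a triangular number. -/
theorem exists_triangular_of_sq_add_sq_add_sq {n : ℕ} {u v w : ℤ} (hu : Odd u) (hv : Even v)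
    (hw : Odd w) (h : 4 * (n : ℤ) + 2 = u ^ 2 + v ^ 2 + w ^ 2) :
    ∃ i j k : ℕ, i * (i + 1) / 2 + j * (j + 1) / 2 + 2 * (k * (k + 1) / 2) = n := by
  obtain ⟨i, hi⟩ := (hu.add_even hv).exists_sq_eq_eight_mul_triangular_add_one
  obtain ⟨j, hj⟩ := (hu.sub_even hv).exists_sq_eq_eight_mul_triangular_add_one
  obtain ⟨k, hk⟩ := hw.exists_sq_eq_eight_mul_triangular_add_one
  refine ⟨i, j, k, ?_⟩
  generalize i * (i + 1) / 2 = I at *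
  generalize j * (j + 1) / 2 = J at *
  generalize k * (k + 1) / 2 = K at *
  zify
  linarith

theorem exists_triangular_add_triangular_add_two_mul_triangular (n : ℕ) :
    ∃ i j k : ℕ, i * (i + 1) / 2 + j * (j + 1) / 2 + 2 * (k * (k + 1) / 2) = n := by
  obtain ⟨u, v, w, h⟩ := exists_sq_add_sq_add_sq_of_mod_four_eq_two (4 * n + 2) (by lia)
  push_cast at h
  have heven : ∀ t : ℤ, Even t → ∃ s, t ^ 2 = 4 * s := by
    rintro t ⟨s, rfl⟩
    exact ⟨s ^ 2, by ring⟩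
  have hodd : ∀ t : ℤ, Odd t → ∃ s, t ^ 2 = 4 * s + 1 := by
    rintro t ⟨s, rfl⟩
    exact ⟨s ^ 2 + s, by ring⟩
  rcases Int.even_or_odd u with hu | hu <;> rcases Int.even_or_odd v with hv | hv <;>
    rcases Int.even_or_odd w with hw | hw
  case inl.inr.inr =>
    exact exists_triangular_of_sq_add_sq_add_sq hv hu hw (by linarith)
  case inr.inl.inr =>
    exact exists_triangular_of_sq_add_sq_add_sq hu hv hw h
  case inr.inr.inl =>
    exact exists_triangular_of_sq_add_sq_add_sq hu hw hv (by linarith)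
  all_goals
    obtain ⟨u', hu'⟩ := by first | exact heven u hu | exact hodd u hu
    obtain ⟨v', hv'⟩ := by first | exact heven v hv | exact hodd v hv
    obtain ⟨w', hw'⟩ := by first | exact heven w hw | exact hodd w hw
    lia

theorem le_triangular (i : ℕ) : i ≤ i * (i + 1) / 2 := by
  rw [Nat.le_div_iff_mul_le two_pos]
  rcases i with _ | i
  · simp
  · gcongr
    lia

/-- Every natural number is a sum of two triangular numbers plus twice a triangular
number. -/
theorem stmt1 (n : ℕ) :
    0 < Set.ncard {x : ℕ × ℕ × ℕ |
      x.1 * (x.1 + 1) / 2 + x.2.1 * (x.2.1 + 1) / 2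
        + 2 * (x.2.2 * (x.2.2 + 1) / 2) = n} := by
  obtain ⟨i, j, k, h⟩ := exists_triangular_add_triangular_add_two_mul_triangular n
  refine (Set.ncard_pos ((Set.finite_Iic (n, n, n)).subset ?_)).2 ⟨(i, j, k), h⟩
  rintro ⟨i, j, k⟩ h
  have hi := le_triangular i
  have hj := le_triangular j
  have hk := le_triangular k
  simp only [Set.mem_ofPred_eq] at h
  simp only [Set.mem_Iic, Prod.mk_le_mk]
  lia
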